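/- Let k ≥ 1 be an integer, s > 0, c ∈ ℝ, and let D be a random variable with distribution N(0,s²). Let S₁ = ⋃_{l∈ℤ} [c + l·2^k − 1/2, c + l·2^k + 1/2] (the intervals consistent with the k-th bit) and S₂ = ⋃_{l∈ℤ} [(c − 2^{k−1}) + l·2^k − 1/2, (c − 2^{k−1}) + l·2^k + 1/2] (the inconsistent intervals). Then P(D ∈ S₁) + P(D ∈ S₂) > 0 and the error likelihood satisfies P(D ∈ S₂) / ( P(D ∈ S₁) + P(D ∈ S₂) ) = A₂(k,c) / ( A₁(k,c) + A₂(k,c) ), where A₁(k,c) = (1/2^k)·( 1 + 2·Σ_{l=1}^{∞} exp(−(1/2)(πsl/2^{k−1})²) · cos(πcl/2^{k−1}) · sinc(l/2^k) ) and A₂(k,c) = A₁(k, 2^{k−1} − c). -/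

import Mathlib

open MeasureTheory ProbabilityTheory Real Set

/-- The normalized sinc function: `sinc u = sin (π u) / (π u)` for `u ≠ 0`, `sinc 0 = 1`. -/
noncomputable def sinc (u : ℝ) : ℝ := if u = 0 then 1 else Real.sin (Real.pi * u) / (Real.pi * u)

/-- The closed-form expression `A₁(k,c)` for the probability that a centered Gaussian with
standard deviation `s` lands in the `2^k`-periodic union of unit-width intervals at offset `c`. -/
noncomputable def A₁ (k : ℕ) (s c : ℝ) : ℝ :=
  (1 / 2 ^ k) * (1 + 2 * ∑' l : ℕ,
    Real.exp (-(1 / 2) * (Real.pi * s * (l + 1) / 2 ^ (k - 1)) ^ 2) *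
      Real.cos (Real.pi * c * (l + 1) / 2 ^ (k - 1)) * _root_.sinc ((l + 1) / 2 ^ k))

open scoped NNReal

lemma hasSum_gaussianPDFReal_periodized {s M : ℝ} (hs : 0 < s) (hM : 0 < M) (y : ℝ) :
    HasSum (fun l : ℤ ↦ gaussianPDFReal 0 ⟨s ^ 2, sq_nonneg s⟩ (y + l * M))
      (1 / M * (1 + ∑' n : ℕ, 2 * Real.cos (2 * π * (y / M) * (n + 1)) *
        rexp (-π * (n + 1) ^ 2 * (2 * π * s ^ 2 / M ^ 2)))) := by
  have hu : 0 < 2 * π * s ^ 2 / M ^ 2 := by positivity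
  have ht : 0 < 1 / (2 * π * s ^ 2 / M ^ 2) := by positivity
  have h := HurwitzZeta.hasSum_int_evenKernel (y / M) ht
  rw [HurwitzZeta.evenKernel_functional_equation, one_div_one_div,
    ← sub_add_cancel (HurwitzZeta.cosKernel _ _) 1,
    ← (HurwitzZeta.hasSum_nat_cosKernel₀ (y / M) hu).tsum_eq, add_comm _ (1 : ℝ)] at h
  have hsqrt : (1 / (2 * π * s ^ 2 / M ^ 2)) ^ (1 / 2 : ℝ) = M / √(2 * π * s ^ 2) := by
    rw [← Real.sqrt_eq_rpow, one_div_div, Real.sqrt_div (sq_nonneg M), Real.sqrt_sq hM.le]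
  rw [hsqrt] at h
  convert! h.mul_left (√(2 * π * s ^ 2))⁻¹ using 1
  · ext l
    change (√(2 * π * s ^ 2))⁻¹ * rexp (-(y + l * M - 0) ^ 2 / (2 * s ^ 2)) = _
    congr 2
    field_simp
    ring
  · rw [← mul_assoc]
    congr 1
    field_simp

lemma integral_cos_mul_eq_sinc {M : ℝ} (hM : 0 < M) (c : ℝ) (n : ℕ) :
    ∫ y in (c - 1 / 2)..(c + 1 / 2), Real.cos (2 * π * (y / M) * (n + 1)) =
      Real.cos (2 * π * (c / M) * (n + 1)) * _root_.sinc ((n + 1) / M) := by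
  have hn : (0 : ℝ) < n + 1 := by positivity
  have hw : 2 * π * (n + 1) / M ≠ 0 := by positivity
  have h1 : ∀ y : ℝ, 2 * π * (y / M) * (n + 1) = 2 * π * (n + 1) / M * y := fun y ↦ by ring
  simp_rw [h1]
  rw [intervalIntegral.integral_comp_mul_left (fun x ↦ Real.cos x) hw, integral_cos,
    Real.sin_sub_sin, _root_.sinc, if_neg (by positivity)]
  have h2 : (2 * π * (n + 1) / M * (c + 1 / 2) - 2 * π * (n + 1) / M * (c - 1 / 2)) / 2 =
      π * ((n + 1) / M) := by ring
  have h3 : (2 * π * (n + 1) / M * (c + 1 / 2) + 2 * π * (n + 1) / M * (c - 1 / 2)) / 2 =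
      2 * π * (n + 1) / M * c := by ring
  rw [h2, h3, smul_eq_mul]
  field_simp

lemma integral_periodized_series {s M : ℝ} (hs : 0 < s) (hM : 0 < M) (c : ℝ) :
    ∫ y in (c - 1 / 2)..(c + 1 / 2), 1 / M * (1 + ∑' n : ℕ,
        2 * Real.cos (2 * π * (y / M) * (n + 1)) *
          rexp (-π * (n + 1) ^ 2 * (2 * π * s ^ 2 / M ^ 2))) =
      1 / M * (1 + 2 * ∑' n : ℕ, rexp (-π * (n + 1) ^ 2 * (2 * π * s ^ 2 / M ^ 2)) *
        Real.cos (2 * π * (c / M) * (n + 1)) * _root_.sinc ((n + 1) / M)) := by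
  have hu : 0 < 2 * π * s ^ 2 / M ^ 2 := by positivity
  have hsum : Summable fun n : ℕ ↦
      2 * rexp (-π * (n + 1) ^ 2 * (2 * π * s ^ 2 / M ^ 2)) := by
    simpa using (HurwitzZeta.hasSum_nat_cosKernel₀ 0 hu).summable
  have hbound : ∀ (n : ℕ) (y : ℝ), ‖2 * Real.cos (2 * π * (y / M) * (n + 1)) *
      rexp (-π * (n + 1) ^ 2 * (2 * π * s ^ 2 / M ^ 2))‖ ≤
      2 * rexp (-π * (n + 1) ^ 2 * (2 * π * s ^ 2 / M ^ 2)) := fun n y ↦ by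
    rw [norm_mul, norm_mul, Real.norm_of_nonneg (Real.exp_pos _).le, Real.norm_ofNat,
      Real.norm_eq_abs]
    nlinarith [Real.abs_cos_le_one (2 * π * (y / M) * (n + 1)),
      Real.exp_pos (-π * (n + 1) ^ 2 * (2 * π * s ^ 2 / M ^ 2))]
  have hcont : ∀ n : ℕ, Continuous fun y : ℝ ↦ 2 * Real.cos (2 * π * (y / M) * (n + 1)) *
      rexp (-π * (n + 1) ^ 2 * (2 * π * s ^ 2 / M ^ 2)) := fun n ↦ by fun_prop
  have hswap := intervalIntegral.hasSum_integral_of_dominated_convergence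
    (μ := volume) (a := c - 1 / 2) (b := c + 1 / 2)
    (F := fun (n : ℕ) (y : ℝ) ↦ 2 * Real.cos (2 * π * (y / M) * (n + 1)) *
      rexp (-π * (n + 1) ^ 2 * (2 * π * s ^ 2 / M ^ 2)))
    (fun n _ ↦ 2 * rexp (-π * (n + 1) ^ 2 * (2 * π * s ^ 2 / M ^ 2)))
    (fun n ↦ (hcont n).aestronglyMeasurable)
    (fun n ↦ .of_forall fun y _ ↦ hbound n y)
    (.of_forall fun _ _ ↦ hsum) (by simp)
    (.of_forall fun y _ ↦ (Summable.of_norm_bounded hsum (hbound · y)).hasSum)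
  have hint : IntervalIntegrable (fun y : ℝ ↦ ∑' n : ℕ,
      2 * Real.cos (2 * π * (y / M) * (n + 1)) *
        rexp (-π * (n + 1) ^ 2 * (2 * π * s ^ 2 / M ^ 2))) volume (c - 1 / 2) (c + 1 / 2) :=
    (continuous_tsum hcont hsum hbound).intervalIntegrable _ _
  rw [intervalIntegral.integral_const_mul, intervalIntegral.integral_add (by simp) hint,
    ← hswap.tsum_eq, ← tsum_mul_left]
  congr 2
  · norm_num
  · congr 1 with n
    rw [intervalIntegral.integral_mul_const, intervalIntegral.integral_const_mul,
      integral_cos_mul_eq_sinc hM]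
    ring

lemma gaussianReal_iUnion_Icc {s M : ℝ} (hs : 0 < s) (hM : 1 < M) (c : ℝ) :
    (gaussianReal 0 ⟨s ^ 2, sq_nonneg s⟩
      (⋃ l : ℤ, Icc (c + l * M - 1 / 2) (c + l * M + 1 / 2))).toReal =
      1 / M * (1 + 2 * ∑' n : ℕ, rexp (-π * (n + 1) ^ 2 * (2 * π * s ^ 2 / M ^ 2)) *
        Real.cos (2 * π * (c / M) * (n + 1)) * _root_.sinc ((n + 1) / M)) := by
  have hM0 : 0 < M := by linarith
  set v : ℝ≥0 := ⟨s ^ 2, sq_nonneg s⟩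
  have hv0 : v ≠ 0 := fun h ↦ (pow_pos hs 2).ne' (congrArg NNReal.toReal h)
  have hdisj : Pairwise (Function.onFun Disjoint
      fun l : ℤ ↦ Icc (c + l * M - 1 / 2) (c + l * M + 1 / 2)) := by
    have key : ∀ i j : ℤ, i < j → c + i * M + 1 / 2 < c + j * M - 1 / 2 := fun i j hij ↦ by
      have : (i : ℝ) + 1 ≤ j := by exact_mod_cast hij
      nlinarith
    intro i j hij
    refine Set.disjoint_left.mpr fun x hi hj ↦ ?_
    rcases hij.lt_or_gt with h | h
    · linarith [key i j h, hi.2, hj.1]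
    · linarith [key j i h, hj.2, hi.1]
  have hg := integrable_gaussianPDFReal 0 v
  have hpieces := hasSum_integral_iUnion (f := gaussianPDFReal 0 v) (μ := volume)
    (s := fun l : ℤ ↦ Icc (c + l * M - 1 / 2) (c + l * M + 1 / 2))
    (fun l ↦ measurableSet_Icc) hdisj hg.integrableOn
  have hshift : ∀ l : ℤ, ∫ x in Icc (c + l * M - 1 / 2) (c + l * M + 1 / 2),
      gaussianPDFReal 0 v x =
      ∫ y in Ioc (c - 1 / 2) (c + 1 / 2), gaussianPDFReal 0 v (y + l * M) := fun l ↦ by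
    rw [integral_Icc_eq_integral_Ioc, ← intervalIntegral.integral_of_le (by linarith),
      ← intervalIntegral.integral_of_le (by linarith),
      intervalIntegral.integral_comp_add_right (gaussianPDFReal 0 v)]
    congr 1 <;> ring
  simp_rw [hshift] at hpieces
  have hswap := hasSum_integral_of_summable_integral_norm
    (μ := volume.restrict (Ioc (c - 1 / 2) (c + 1 / 2)))
    (F := fun (l : ℤ) y ↦ gaussianPDFReal 0 v (y + l * M))
    (fun l ↦ (hg.comp_add_right (l * M)).integrableOn) (by
      simp_rw [Real.norm_of_nonneg (gaussianPDFReal_nonneg 0 v _)]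
      exact hpieces.summable)
  rw [gaussianReal_apply_eq_integral 0 hv0, ENNReal.toReal_ofReal
    (integral_nonneg fun x ↦ gaussianPDFReal_nonneg 0 v x), hpieces.unique hswap,
    ← integral_periodized_series hs hM0, intervalIntegral.integral_of_le (by linarith)]
  exact integral_congr_ae 
    (.of_forall fun y ↦ (hasSum_gaussianPDFReal_periodized hs hM0 y).tsum_eq)

lemma gaussianReal_iUnion_Icc_eq_A₁ {k : ℕ} (hk : 1 ≤ k) {s : ℝ} (hs : 0 < s) (c : ℝ) :
    (gaussianReal 0 ⟨s ^ 2, sq_nonneg s⟩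
      (⋃ l : ℤ, Icc (c + l * 2 ^ k - 1 / 2) (c + l * 2 ^ k + 1 / 2))).toReal = A₁ k s c := by
  rw [gaussianReal_iUnion_Icc hs (one_lt_pow₀ one_lt_two (by lia)), A₁]
  obtain ⟨m, rfl⟩ := Nat.exists_eq_add_of_le' hk
  simp only [Nat.add_sub_cancel]
  congr 4 with n
  congr 3 <;> (simp only [pow_succ]; field_simp)

lemma A₁_neg (k : ℕ) (s c : ℝ) : A₁ k s (-c) = A₁ k s c := by
  simp only [A₁, mul_neg, neg_mul, neg_div, Real.cos_neg]

/-- **Theorem 2 of the paper.** For `D ~ N(0,s²)`, with `S₁` the union of quantization intervals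
consistent with the `k`-th bit and `S₂` the inconsistent ones, the total probability
`P(D ∈ S₁) + P(D ∈ S₂)` is positive and the error likelihood equals
`A₂(k,c)/(A₁(k,c) + A₂(k,c))` with `A₂(k,c) = A₁(k, 2^{k−1} − c)`. -/
theorem error_likelihood
    {Ω : Type*} [MeasurableSpace Ω] (P : Measure Ω) [IsProbabilityMeasure P]
    (k : ℕ) (hk : 1 ≤ k) (s : ℝ) (hs : 0 < s) (c : ℝ)
    (D : Ω → ℝ) (hD_meas : Measurable D)
    (hD : Measure.map D P = gaussianReal 0 ⟨s ^ 2, sq_nonneg s⟩) :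
    0 < (P {ω | ∃ l : ℤ, D ω ∈
          Set.Icc (c + (l : ℝ) * 2 ^ k - 1 / 2) (c + (l : ℝ) * 2 ^ k + 1 / 2)}).toReal +
        (P {ω | ∃ l : ℤ, D ω ∈
          Set.Icc ((c - 2 ^ (k - 1)) + (l : ℝ) * 2 ^ k - 1 / 2)
            ((c - 2 ^ (k - 1)) + (l : ℝ) * 2 ^ k + 1 / 2)}).toReal ∧
    (P {ω | ∃ l : ℤ, D ω ∈
          Set.Icc ((c - 2 ^ (k - 1)) + (l : ℝ) * 2 ^ k - 1 / 2)
            ((c - 2 ^ (k - 1)) + (l : ℝ) * 2 ^ k + 1 / 2)}).toReal /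
      ((P {ω | ∃ l : ℤ, D ω ∈
          Set.Icc (c + (l : ℝ) * 2 ^ k - 1 / 2) (c + (l : ℝ) * 2 ^ k + 1 / 2)}).toReal +
       (P {ω | ∃ l : ℤ, D ω ∈
          Set.Icc ((c - 2 ^ (k - 1)) + (l : ℝ) * 2 ^ k - 1 / 2)
            ((c - 2 ^ (k - 1)) + (l : ℝ) * 2 ^ k + 1 / 2)}).toReal) =
      A₁ k s (2 ^ (k - 1) - c) / (A₁ k s c + A₁ k s (2 ^ (k - 1) - c)) := by
  have hprob : ∀ a : ℝ, (P {ω | ∃ l : ℤ, D ω ∈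
      Set.Icc (a + (l : ℝ) * 2 ^ k - 1 / 2) (a + (l : ℝ) * 2 ^ k + 1 / 2)}).toReal =
      A₁ k s a := fun a ↦ by
    rw [← gaussianReal_iUnion_Icc_eq_A₁ hk hs, ← hD,
      Measure.map_apply hD_meas (MeasurableSet.iUnion fun l ↦ measurableSet_Icc)]
    congr 2
    ext ω
    simp
  have hpos : 0 < A₁ k s c := by
    have hv0 : (⟨s ^ 2, sq_nonneg s⟩ : ℝ≥0) ≠ 0 :=
      fun h ↦ (pow_pos hs 2).ne' (congrArg NNReal.toReal h)
    rw [← gaussianReal_iUnion_Icc_eq_A₁ hk hs]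
    have := instIsProbabilityMeasureGaussianReal 0 ⟨s ^ 2, sq_nonneg s⟩
    refine ENNReal.toReal_pos (fun h ↦ ?_) (measure_ne_top _ _)
    have h0 := measure_mono_null (subset_iUnion _ (0 : ℤ))
      (gaussianReal_absolutelyContinuous' 0 hv0 h)
    rw [Real.volume_Icc, ENNReal.ofReal_eq_zero] at h0
    linarith
  rw [hprob, hprob, ← A₁_neg k s (c - _), neg_sub]
  refine ⟨add_pos_of_pos_of_nonneg hpos ?_, rfl⟩
  rw [← neg_sub, A₁_neg, ← hprob]
  exact ENNReal.toReal_nonneg
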